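/- Let $n\geq 2$, $\gamma\in(0,1)$, and define $C(\alpha)=\varsigma_{n,\gamma}\kappa^n_{\alpha,\gamma}-c_{n,\gamma}$ where $\kappa^n_{\alpha,\gamma}=\mathrm{P.V.}\int_{\mathbb{R}^n}\frac{1-|\zeta|^{-\nu}}{|e_1-\zeta|^{n+2\gamma}|\zeta|^{\alpha}}\,d\zeta$ with $\nu=\frac{n-2\gamma}{2}-\alpha$. Then $C$ is strictly decreasing on $(-2\gamma,\frac{n-2\gamma}{2})$, $C(0)=0$, and $C(\alpha)+c_{n,\gamma}>0$ for all $-2\gamma<\alpha<\frac{n-2\gamma}{2}$. -/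

import Mathlib

open Filter Topology MeasureTheory

abbrev EE (n : ℕ) := EuclideanSpace ℝ (Fin n)

noncomputable def gk {n : ℕ} (e : EE n) (p α : ℝ) (x : EE n) : ℝ := ‖x‖ ^ (-α) * ‖e - x‖ ^ (-p)

lemma gk_meas {n : ℕ} (e : EE n) (p α : ℝ) : Measurable (gk e p α) := by
  unfold gk; fun_prop

lemma gk_nonneg {n : ℕ} (e : EE n) (p α : ℝ) (x) : 0 ≤ gk e p α x := by
  unfold gk; positivity

lemma dim_EE (n : ℕ) : Module.finrank ℝ (EE n) = n := by simp

lemma rpow_int_ball {n : ℕ} (hn : 1 ≤ n) {a r : ℝ} (ha : a < n) :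
    IntegrableOn (fun x : EE n => ‖x‖ ^ (-a)) (Metric.ball 0 r) := by
  refine integrableOn_ball_of_norm_le_rpow (C := 1) (α := a) (by simpa using hn) (by simpa using ha) ?_ ?_
  · refine Eventually.of_forall fun x => ?_
    rw [Real.norm_of_nonneg (by positivity)]; simp
  · exact (by fun_prop : Measurable fun x : EE n => ‖x‖ ^ (-a)).aestronglyMeasurable

lemma rpow_int_out {n : ℕ} (hn : 1 ≤ n) {a : ℝ} (ha : (n:ℝ) < a) :
    IntegrableOn (fun x : EE n => ‖x‖ ^ (-a)) (Metric.ball 0 1)ᶜ := by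
  have : Nontrivial (EE n) := by
    apply Module.nontrivial_of_finrank_pos (R := ℝ)
    simp; omega
  rw [← integrable_indicator_iff Metric.isOpen_ball.measurableSet.compl]
  have h := (integrable_fun_norm_addHaar (volume : Measure (EE n)) (f := (Set.Ici 1).indicator (fun y : ℝ => y ^ (-a)))).2 ?_
  · refine h.congr (Eventually.of_forall fun x => ?_)
    simp [Set.indicator]
  · have : IntegrableOn (fun y : ℝ => y ^ ((n:ℝ) - 1 - a)) (Set.Ioi 1) := by
      apply integrableOn_Ioi_rpow_of_lt <;> linarith
    rw [← integrableOn_Ici_iff_integrableOn_Ioi, ← integrable_indicator_iff measurableSet_Ici] at this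
    refine (this.integrableOn (s := Set.Ioi 0)).congr_fun (fun y hy => ?_) measurableSet_Ioi
    have hy : 0 < y := hy
    by_cases h1 : 1 ≤ y
    · simp [h1]
      rw [← Real.rpow_natCast, ← Real.rpow_add hy]
      congr 1
      rw [Nat.cast_sub hn]; push_cast; ring
    · simp [h1]

def DD {n : ℕ} (e : EE n) (ε : ℝ) : Set (EE n) := {x | ε < ‖x - e‖}

lemma DD_meas {n : ℕ} (e : EE n) (ε : ℝ) : MeasurableSet (DD e ε) := by
  unfold DD; apply measurableSet_lt <;> fun_prop

lemma gk_int {n : ℕ} (hn : 1 ≤ n) (e : EE n) (he : ‖e‖ = 1) {p α ε : ℝ} (hε : 0 < ε) (hp : 0 < p)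
    (h1 : n < α + p) (h2 : α < n) : IntegrableOn (gk e p α) (DD e ε) := by
  rw [← Set.inter_union_compl (DD e ε) (Metric.ball 0 1)]
  refine IntegrableOn.union ?_ ?_
  · have h := (rpow_int_ball hn (r := 1) h2).const_mul (ε ^ (-p))
    refine Integrable.mono' (IntegrableOn.mono_set h Set.inter_subset_right) (gk_meas e p α).aestronglyMeasurable ?_
    refine (ae_restrict_iff' ((DD_meas e ε).inter Metric.isOpen_ball.measurableSet)).2 (Eventually.of_forall ?_)
    rintro x ⟨hx, -⟩
    rw [Real.norm_of_nonneg (gk_nonneg ..), gk, mul_comm]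
    refine mul_le_mul_of_nonneg_right ?_ (by positivity)
    have hx : ε < ‖x - e‖ := hx
    rw [norm_sub_rev] at hx
    exact Real.rpow_le_rpow_of_nonpos hε hx.le (by linarith)
  · have h := (rpow_int_out hn (a := α + p) (by linarith)).const_mul ((1 + 1 / ε) ^ p)
    refine Integrable.mono' (IntegrableOn.mono_set h Set.inter_subset_right) (gk_meas e p α).aestronglyMeasurable ?_
    refine (ae_restrict_iff' ((DD_meas e ε).inter Metric.isOpen_ball.measurableSet.compl)).2 (Eventually.of_forall ?_)
    rintro x ⟨hx, hx1⟩
    rw [Real.norm_of_nonneg (gk_nonneg ..), gk]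
    have hx : ε < ‖x - e‖ := hx
    have hx1 : 1 ≤ ‖x‖ := by simpa using hx1
    rw [norm_sub_rev] at hx
    have hx0 : 0 < ‖x‖ := by linarith
    have h3 : ‖x‖ ≤ ‖e - x‖ + 1 := by
      have := norm_sub_norm_le x e
      rw [norm_sub_rev] at this; linarith
    have h4 : ‖x‖ / (1 + 1/ε) ≤ ‖e - x‖ := by
      rw [div_le_iff₀ (by positivity)]
      have : 1 ≤ ‖e - x‖ / ε := by rw [le_div_iff₀ hε]; linarith
      calc _ ≤ _ := h3
        _ ≤ ‖e - x‖ + ‖e-x‖ / ε := by gcongr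
        _ = _ := by ring
    rw [neg_add, Real.rpow_add hx0, mul_left_comm]
    gcongr
    calc _ ≤ (‖x‖ / (1 + 1/ε)) ^ (-p) := Real.rpow_le_rpow_of_nonpos (by positivity) h4 (by linarith)
      _ = _ := by
        rw [Real.div_rpow (by positivity) (by positivity), Real.rpow_neg (by positivity : (0:ℝ) ≤ 1 + 1/ε)]
        field_simp

lemma inv_det {n : ℕ} (x : EE n) (hx : x ≠ 0) :
    |(((1 / dist x 0) ^ 2 • (((ℝ ∙ (x - 0))ᗮ.reflection : EE n ≃ₗᵢ[ℝ] EE n) : EE n →L[ℝ] EE n)) : EE n →L[ℝ] EE n).det| = ‖x‖ ^ (-(2 * (n:ℝ))) := by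
  have h0 : 0 < ‖x‖ := norm_pos_iff.2 hx
  have : LinearMap.det ((((ℝ ∙ (x - 0))ᗮ.reflection : EE n ≃ₗᵢ[ℝ] EE n) : EE n →L[ℝ] EE n) : EE n →ₗ[ℝ] EE n) = (-1) ^ Module.finrank ℝ ((ℝ ∙ (x - 0))ᗮ)ᗮ := by
    exact Submodule.det_reflection ((ℝ ∙ (x - 0))ᗮ)
  rw [ContinuousLinearMap.det, ContinuousLinearMap.toLinearMap_smul, LinearMap.det_smul, this]
  simp only [abs_mul, abs_pow, abs_neg, abs_one, one_pow, mul_one, dim_EE]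
  rw [dist_zero_right, abs_of_pos (by positivity), ← pow_mul, Real.rpow_neg h0.le, one_div, inv_pow]
  congr 1
  exact_mod_cast (Real.rpow_natCast ‖x‖ (2*n)).symm

lemma norm_invE {n : ℕ} (x : EE n) : ‖EuclideanGeometry.inversion 0 1 x‖ = ‖x‖⁻¹ := by
  have := EuclideanGeometry.dist_inversion_center (0 : EE n) x 1
  simpa using this

lemma dist_inv_e {n : ℕ} (e : EE n) (he : ‖e‖ = 1) (x : EE n) (hx : x ≠ 0) :
    ‖e - EuclideanGeometry.inversion 0 1 x‖ = ‖e - x‖ / ‖x‖ := by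
  have he0 : e ≠ 0 := by rintro rfl; simp at he
  have h := EuclideanGeometry.dist_inversion_inversion he0 hx 1
  have h2 : EuclideanGeometry.inversion 0 1 e = e := by
    apply EuclideanGeometry.inversion_of_mem_sphere; simp [he]
  rw [h2] at h
  simp [dist_eq_norm, he] at h
  rw [h]; field_simp

lemma kelvin {n : ℕ} (e : EE n) (he : ‖e‖ = 1) (p α ε : ℝ) :
    ∫ x in DD e ε ∩ {x | 0 < ‖x‖ ∧ ‖x‖ < 1}, gk e p α x =
    ∫ x in {x | 1 < ‖x‖ ∧ ε * ‖x‖ < ‖e - x‖}, gk e p (2 * n - p - α) x := by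
  have hS : MeasurableSet {x : EE n | 1 < ‖x‖ ∧ ε * ‖x‖ < ‖e - x‖} := by
    rw [Set.ofPred_and]; apply MeasurableSet.inter <;> apply measurableSet_lt <;> fun_prop
  have himg : EuclideanGeometry.inversion 0 1 '' {x : EE n | 1 < ‖x‖ ∧ ε * ‖x‖ < ‖e - x‖}
      = DD e ε ∩ {x | 0 < ‖x‖ ∧ ‖x‖ < 1} := by
    rw [(EuclideanGeometry.inversion_involutive (0 : EE n) one_ne_zero).image_eq_preimage_symm]
    ext x
    simp only [Set.mem_preimage, Set.mem_ofPred_eq, Set.mem_inter_iff, DD, norm_invE]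
    by_cases hx : x = 0
    · simp [hx, EuclideanGeometry.inversion_self]
    have h0 : 0 < ‖x‖ := norm_pos_iff.2 hx
    rw [dist_inv_e e he x hx, one_lt_inv₀ h0, norm_sub_rev x e, ← div_eq_mul_inv, div_lt_div_iff_of_pos_right h0]
    tauto
  rw [← himg, integral_image_eq_integral_abs_det_fderiv_smul volume hS (f := EuclideanGeometry.inversion 0 1)
    (f' := fun x => ((1 / dist x 0) ^ 2 • (((ℝ ∙ (x - 0))ᗮ.reflection : EE n ≃ₗᵢ[ℝ] EE n) : EE n →L[ℝ] EE n)))]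
  · refine setIntegral_congr_fun hS fun x hx => ?_
    have h1 : 1 < ‖x‖ := hx.1
    have h0 : 0 < ‖x‖ := by linarith
    have hx0 : x ≠ 0 := norm_pos_iff.1 h0
    rw [inv_det x hx0, gk, gk, norm_invE, dist_inv_e e he x hx0, smul_eq_mul,
      Real.div_rpow (by positivity) (by positivity), Real.inv_rpow (by positivity), ← Real.rpow_neg (by positivity), div_eq_mul_inv, ← Real.rpow_neg (by positivity)]
    rw [show -(2 * (n:ℝ) - p - α) = -(2 * n) + - -α + - -p by ring, Real.rpow_add h0, Real.rpow_add h0]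
    ring
  · intro x hx
    have h1 : 1 < ‖x‖ := hx.1
    have hx0 : x ≠ 0 := norm_pos_iff.1 (by linarith)
    exact (EuclideanGeometry.hasFDerivAt_inversion hx0).hasFDerivWithinAt
  · exact (EuclideanGeometry.inversion_injective (0 : EE n) one_ne_zero).injOn

lemma W_pos {r s α β : ℝ} (hr : 1 < r) (h : α < β) (h2 : α + β < s) :
    0 < r ^ (-α) - r ^ (-β) + (r ^ (-(s - α)) - r ^ (-(s - β))) := by
  have h0 : 0 < r := by linarith
  have : r ^ (-α) - r ^ (-β) + (r ^ (-(s - α)) - r ^ (-(s - β))) = (r ^ (β - α) - 1) * (r ^ (-β) - r ^ (-(s-α))) := by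
    rw [sub_mul, mul_sub, ← Real.rpow_add h0, ← Real.rpow_add h0]
    ring_nf
  rw [this]
  apply mul_pos
  · have := Real.one_lt_rpow hr (show 0 < β - α by linarith)
    linarith
  · have := Real.rpow_lt_rpow_of_exponent_lt hr (show -(s-α) < -β by linarith)
    linarith

lemma mono_main {n : ℕ} (hn : 1 ≤ n) (e : EE n) (he : ‖e‖ = 1) {γ α β : ℝ} (hγ : 0 < γ)
    (h1 : -(2*γ) < α) (h2 : α < β) (h3 : β ≤ ((n:ℝ) - 2*γ)/2) :
    ∃ δ > 0, ∀ ε, 0 < ε → ε < 1/2 →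
      δ ≤ ∫ x in DD e ε, (gk e (n + 2*γ) α x - gk e (n + 2*γ) β x) := by
  have hn' : (1:ℝ) ≤ n := by exact_mod_cast hn
  set p : ℝ := n + 2*γ with hp
  set s : ℝ := 2 * n - p with hs
  let A : Set (EE n) := {x | 1 < ‖x‖}
  have hA : MeasurableSet A := by apply measurableSet_lt <;> fun_prop
  let W : EE n → ℝ := fun x => gk e p α x - gk e p β x + (gk e p (s - α) x - gk e p (s - β) x)
  have hi : ∀ a, -(2*γ) < a → a < n → ∀ ε, 0 < ε → IntegrableOn (gk e p a) (DD e ε) := by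
    intro a ha ha' ε hε
    exact gk_int hn e he hε (by positivity) (by linarith) ha'
  have hWi : ∀ ε, 0 < ε → IntegrableOn W (DD e ε) := by
    intro ε hε
    exact ((hi α h1 (by linarith) ε hε).sub (hi β (by linarith) (by linarith) ε hε)).add
      ((hi (s - α) (by linarith) (by linarith) ε hε).sub (hi (s-β) (by linarith) (by linarith) ε hε))
  have hWeq : ∀ x, W x = (‖x‖ ^ (-α) - ‖x‖ ^ (-β) + (‖x‖ ^ (-(s - α)) - ‖x‖ ^ (-(s - β)))) * ‖e - x‖ ^ (-p) := by
    intro x; simp only [W, gk]; ring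
  have hW0 : ∀ x ∈ A, 0 ≤ W x := by
    intro x hx
    rw [hWeq]
    exact mul_nonneg (W_pos hx h2 (by linarith)).le (by positivity)
  refine ⟨∫ x in DD e (1/2) ∩ A, W x, ?_, ?_⟩
  · rw [gt_iff_lt, setIntegral_pos_iff_support_of_nonneg_ae]
    · have hop : IsOpen (DD e (1/2) ∩ A) := by
        apply IsOpen.inter
        · unfold DD; apply isOpen_lt <;> fun_prop
        · apply isOpen_lt <;> fun_prop
      have hne : (DD e (1/2) ∩ A).Nonempty := by
        refine ⟨(3:ℝ) • e, ?_, ?_⟩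
        · show 1/2 < ‖(3:ℝ) • e - e‖
          rw [show (3:ℝ) • e - e = (2:ℝ) • e by module, norm_smul, he]; norm_num
        · show 1 < ‖(3:ℝ) • e‖
          rw [norm_smul, he]; norm_num
      refine (hop.measure_pos volume hne).trans_le (measure_mono ?_)
      rintro x ⟨hx, hxA⟩
      refine ⟨?_, hx, hxA⟩
      rw [Function.mem_support, hWeq]
      have hx : 1/2 < ‖x - e‖ := hx
      rw [norm_sub_rev] at hx
      have : 0 < ‖e - x‖ := by linarith
      have := mul_pos (W_pos (s := s) hxA h2 (by linarith)) (Real.rpow_pos_of_pos this (-p))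
      exact this.ne'
    · exact (ae_restrict_iff' ((DD_meas _ _).inter hA)).2 (Eventually.of_forall fun x hx => hW0 x hx.2)
    · exact (hWi _ (by norm_num)).mono_set Set.inter_subset_left
  · intro ε hε hε2
    let B : Set (EE n) := {x | 0 < ‖x‖ ∧ ‖x‖ < 1}
    let A' : Set (EE n) := {x | 1 < ‖x‖ ∧ ε * ‖x‖ < ‖e - x‖}
    have hB : MeasurableSet B := by
      simp only [B]; rw [Set.ofPred_and]; apply MeasurableSet.inter <;> apply measurableSet_lt <;> fun_prop
    have hA' : MeasurableSet A' := by
      simp only [A']; rw [Set.ofPred_and]; apply MeasurableSet.inter <;> apply measurableSet_lt <;> fun_prop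
    have hA'sub : A' ⊆ DD e ε ∩ A := by
      rintro x ⟨hx, hx'⟩
      refine ⟨?_, hx⟩
      show ε < ‖x - e‖
      rw [norm_sub_rev]
      nlinarith
    have iα := hi α h1 (by linarith) ε hε
    have iβ := hi β (by linarith) (by linarith) ε hε
    have iα' := hi (s - α) (by linarith) (by linarith) ε hε
    have iβ' := hi (s - β) (by linarith) (by linarith) ε hε
    have e1 : ∫ x in DD e ε, (gk e p α x - gk e p β x) =
        (∫ x in DD e ε ∩ A, (gk e p α x - gk e p β x)) + ∫ x in DD e ε ∩ B, (gk e p α x - gk e p β x) := by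
      rw [← setIntegral_union]
      · rw [← Set.inter_union_distrib_left]
        have hz : ∀ᵐ x : EE n, x ≠ 0 := by
          have : Nontrivial (EE n) := by
            apply Module.nontrivial_of_finrank_pos (R := ℝ)
            simp; omega
          simp [ae_iff]
        refine setIntegral_eq_of_subset_of_ae_sdiff_eq_zero (DD_meas _ _).nullMeasurableSet Set.inter_subset_left ?_
        filter_upwards [hz] with x hx0 hx
        have h0 : 0 < ‖x‖ := norm_pos_iff.2 hx0
        have : ‖x‖ = 1 := by
          by_contra hne
          apply hx.2
          refine ⟨hx.1, ?_⟩
          rcases lt_or_gt_of_ne hne with h | h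
          · exact Or.inr ⟨h0, h⟩
          · exact Or.inl h
        simp [gk, this]
      · rw [Set.disjoint_left]; rintro x ⟨_, hx⟩ ⟨_, hx'⟩
        have a1 : 1 < ‖x‖ := hx
        have a2 := hx'.2
        linarith
      · exact (DD_meas _ _).inter hB
      · exact (iα.sub iβ).mono_set Set.inter_subset_left
      · exact (iα.sub iβ).mono_set Set.inter_subset_left
    have e2 : ∫ x in DD e ε ∩ B, (gk e p α x - gk e p β x) = ∫ x in A', (gk e p (s - α) x - gk e p (s - β) x) := by
      rw [integral_sub (iα.mono_set Set.inter_subset_left) (iβ.mono_set Set.inter_subset_left), kelvin e he, kelvin e he, ← integral_sub]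
      · exact iα'.mono_set (hA'sub.trans Set.inter_subset_left)
      · exact iβ'.mono_set (hA'sub.trans Set.inter_subset_left)
    have e3 : ∫ x in DD e ε ∩ A, (gk e p (s - α) x - gk e p (s - β) x) ≤ ∫ x in A', (gk e p (s - α) x - gk e p (s - β) x) := by
      have := setIntegral_mono_set (f := fun x => -(gk e p (s - α) x - gk e p (s - β) x)) (s := A') (t := DD e ε ∩ A) (μ := volume) ?_ ?_ (Eventually.of_forall hA'sub)
      · rw [integral_neg, integral_neg] at this; linarith
      · exact ((iα'.sub iβ').mono_set Set.inter_subset_left).neg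
      · refine (ae_restrict_iff' ((DD_meas _ _).inter hA)).2 (Eventually.of_forall fun x hx => ?_)
        have hx1 : 1 < ‖x‖ := hx.2
        simp only [gk, Pi.zero_apply, neg_sub, sub_nonneg]
        gcongr
        exact hx1.le
    have e4 : ∫ x in DD e ε ∩ A, W x = (∫ x in DD e ε ∩ A, (gk e p α x - gk e p β x)) + ∫ x in DD e ε ∩ A, (gk e p (s - α) x - gk e p (s - β) x) := by
      apply integral_add
      · exact (iα.sub iβ).mono_set Set.inter_subset_left
      · exact (iα'.sub iβ').mono_set Set.inter_subset_left
    have e5 : ∫ x in DD e (1/2) ∩ A, W x ≤ ∫ x in DD e ε ∩ A, W x := by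
      apply setIntegral_mono_set
      · exact (hWi ε hε).mono_set Set.inter_subset_left
      · exact (ae_restrict_iff' ((DD_meas _ _).inter hA)).2 (Eventually.of_forall fun x hx => hW0 x hx.2)
      · refine Eventually.of_forall ?_
        rintro x ⟨hx, hx'⟩
        exact ⟨lt_trans hε2 hx, hx'⟩
    linarith

lemma gam_int {m r : ℝ} (hm : 0 < m) (hr : 0 < r) :
    IntegrableOn (fun t : ℝ => t ^ (m - 1) * Real.exp (-(r * t))) (Set.Ioi 0) := by
  apply Integrable.of_integral_ne_zero
  rw [Real.integral_rpow_mul_exp_neg_mul_Ioi hm hr]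
  have := Real.Gamma_pos_of_pos hm
  positivity

lemma laplace_fubini {X : Type*} [MeasurableSpace X] (μ : Measure X) [SFinite μ] {φ h : X → ℝ}
    (hφ : Measurable φ) (hh : Measurable h) (hpos : ∀ᵐ x ∂μ, 0 < φ x) {m : ℝ} (hm : 0 < m)
    (hint : Integrable (fun x => φ x ^ (-m) * h x) μ) :
    ∫ s in Set.Ioi (0:ℝ), s ^ (m - 1) * ∫ x, Real.exp (-(φ x * s)) * h x ∂μ =
      Real.Gamma m * ∫ x, φ x ^ (-m) * h x ∂μ := by
  have e1 : ∀ s : ℝ, s ^ (m - 1) * ∫ x, Real.exp (-(φ x * s)) * h x ∂μ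
      = ∫ x, s ^ (m-1) * (Real.exp (-(φ x * s)) * h x) ∂μ := fun s => (integral_const_mul _ _).symm
  simp_rw [e1]
  have hmeas : AEStronglyMeasurable (Function.uncurry fun (x : X) (s : ℝ) => s ^ (m-1) * (Real.exp (-(φ x * s)) * h x))
      (μ.prod (volume.restrict (Set.Ioi 0))) := by
    apply Measurable.aestronglyMeasurable
    unfold Function.uncurry
    fun_prop
  have hI : Integrable (Function.uncurry fun (x : X) (s : ℝ) => s ^ (m-1) * (Real.exp (-(φ x * s)) * h x))
      (μ.prod (volume.restrict (Set.Ioi 0))) := by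
    rw [integrable_prod_iff hmeas]
    constructor
    · filter_upwards [hpos] with x hx
      simp only [Function.uncurry]
      have := (gam_int hm hx).mul_const (h x)
      simpa only [mul_assoc] using this
    · refine (hint.norm.const_mul (Real.Gamma m)).congr ?_
      filter_upwards [hpos] with x hx
      simp only [Function.uncurry]
      have : ∫ s in Set.Ioi (0:ℝ), ‖s ^ (m-1) * (Real.exp (-(φ x * s)) * h x)‖ =
          ∫ s in Set.Ioi (0:ℝ), (s ^ (m-1) * Real.exp (-(φ x * s))) * |h x| := by
        refine setIntegral_congr_fun measurableSet_Ioi fun s hs => ?_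
        have hs : 0 < s := hs
        simp only [norm_mul, Real.norm_eq_abs, Real.abs_exp]
        rw [abs_of_pos (by positivity)]; ring
      rw [this, integral_mul_const, Real.integral_rpow_mul_exp_neg_mul_Ioi hm hx, norm_mul, Real.norm_eq_abs, Real.norm_eq_abs,
        abs_of_pos (by positivity), one_div, Real.inv_rpow hx.le, Real.rpow_neg hx.le]
      ring
  rw [← integral_integral_swap hI, ← integral_const_mul]
  apply integral_congr_ae
  filter_upwards [hpos] with x hx
  simp only [← mul_assoc]
  rw [integral_mul_const, Real.integral_rpow_mul_exp_neg_mul_Ioi hm hx, one_div, Real.inv_rpow hx.le, Real.rpow_neg hx.le]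
  ring

lemma beta_real {α β : ℝ} (hα : 0 < α) (hβ : 0 < β) :
    ∫ x in Set.Ioo (0:ℝ) 1, x ^ (α - 1) * (1 - x) ^ (β - 1) = Real.Gamma α * Real.Gamma β / Real.Gamma (α + β) := by
  have h := ProbabilityTheory.beta_eq_betaIntegralReal α β hα hβ
  rw [ProbabilityTheory.beta] at h
  rw [h, Complex.betaIntegral, intervalIntegral.integral_of_le (by norm_num),
      ← integral_Ioc_eq_integral_Ioo, ← RCLike.re_to_complex, ← integral_re]
  · refine setIntegral_congr_fun measurableSet_Ioc fun x ⟨hx1, hx₂⟩ ↦ ?_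
    norm_cast
    rw [← Complex.ofReal_cpow, ← Complex.ofReal_cpow, RCLike.re_to_complex,
        Complex.re_mul_ofReal, Complex.ofReal_re]
    all_goals linarith
  · convert! Complex.betaIntegral_convergent (u := α) (v := β) (by simpa) (by simpa)
    rw [intervalIntegrable_iff_integrableOn_Ioc_of_le (by simp), IntegrableOn]

lemma beta_int {α β : ℝ} (hα : 0 < α) (hβ : 0 < β) :
    IntegrableOn (fun x : ℝ => x ^ (α - 1) * (1 - x) ^ (β - 1)) (Set.Ioo (0:ℝ) 1) := by
  apply Integrable.of_integral_ne_zero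
  rw [beta_real hα hβ]
  have h1 := Real.Gamma_pos_of_pos hα
  have h2 := Real.Gamma_pos_of_pos hβ
  have h3 := Real.Gamma_pos_of_pos (add_pos hα hβ)
  positivity

noncomputable def QQ (b v : ℝ) : ℝ := if v < 1 then 1 - (1 - v) ^ b else 1

lemma QQ_meas (b : ℝ) : Measurable (QQ b) := by
  unfold QQ
  apply Measurable.ite <;> first | exact measurableSet_Iio | fun_prop

lemma one_sub_bound {c v : ℝ} (hc : 0 < c) (h0 : 0 ≤ v) (h1 : v ≤ 1) :
    0 ≤ 1 - (1 - v) ^ c ∧ 1 - (1 - v) ^ c ≤ (1 + c) * v := by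
  constructor
  · have := Real.rpow_le_one (show 0 ≤ 1 - v by linarith) (by linarith) hc.le
    linarith
  · rcases le_total c 1 with h | h
    · have := Real.rpow_le_rpow_of_exponent_ge' (show 0 ≤ 1 - v by linarith) (by linarith) hc.le h
      rw [Real.rpow_one] at this
      nlinarith
    · have := one_add_mul_self_le_rpow_one_add (show -1 ≤ -v by linarith) h
      rw [← sub_eq_add_neg] at this
      nlinarith

lemma D_one {γ c : ℝ} (hγ : 0 < γ) (hγ1 : γ < 1) (hc : 0 < c) :
    IntegrableOn (fun v : ℝ => v ^ (-γ - 1) * (1 - (1 - v) ^ c)) (Set.Ioo 0 1) ∧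
    γ * ∫ v in Set.Ioo (0:ℝ) 1, v ^ (-γ - 1) * (1 - (1 - v) ^ c) =
      c * (∫ v in Set.Ioo (0:ℝ) 1, v ^ ((1 - γ) - 1) * (1 - v) ^ (c - 1)) - 1 := by
  have hI : IntegrableOn (fun v : ℝ => v ^ (-γ - 1) * (1 - (1 - v) ^ c)) (Set.Ioo 0 1) := by
    have h : IntegrableOn (fun v : ℝ => (1 + c) * v ^ (-γ)) (Set.Ioo 0 1) :=
      ((intervalIntegral.integrableOn_Ioo_rpow_iff one_pos).2 (by linarith)).const_mul _
    refine Integrable.mono' h (by apply Measurable.aestronglyMeasurable; fun_prop) ?_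
    refine (ae_restrict_iff' measurableSet_Ioo).2 (Eventually.of_forall fun v hv => ?_)
    obtain ⟨b1, b2⟩ := one_sub_bound hc hv.1.le hv.2.le
    have := hv.1
    rw [Real.norm_of_nonneg (by positivity)]
    calc _ ≤ v ^ (-γ - 1) * ((1 + c) * v) := by gcongr
      _ = _ := by rw [Real.rpow_sub this, Real.rpow_one]; field_simp
  refine ⟨hI, ?_⟩
  have hB := beta_int (α := 1 - γ) (by linarith) hc
  have key := intervalIntegral.integral_eq_sub_of_hasDerivAt_of_le (a := 0) (b := 1) zero_le_one
    (f := fun v : ℝ => v ^ (-γ) * (1 - (1 - v) ^ c))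
    (f' := fun v : ℝ => (-γ) * (v ^ (-γ - 1) * (1 - (1 - v) ^ c)) + c * (v ^ ((1 - γ) - 1) * (1 - v) ^ (c - 1)))
    ?_ ?_ ?_
  · rw [intervalIntegral.integral_of_le zero_le_one, integral_Ioc_eq_integral_Ioo, integral_add (hI.const_mul _) (hB.const_mul _),
      integral_const_mul, integral_const_mul] at key
    simp [Real.zero_rpow hc.ne'] at key
    simp
    linarith
  · intro v hv
    rcases eq_or_lt_of_le hv.1 with rfl | h0
    · have hz : (0:ℝ) ^ (-γ) = 0 := Real.zero_rpow (by linarith)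
      rw [ContinuousWithinAt]
      simp only [sub_zero, Real.one_rpow, sub_self, mul_zero]
      have hl : Tendsto (fun v : ℝ => (1 + c) * v ^ (1 - γ)) (𝓝[Set.Icc 0 1] 0) (𝓝 0) := by
        have : ContinuousAt (fun v : ℝ => (1 + c) * v ^ (1 - γ)) 0 :=
          continuousAt_const.mul (Real.continuousAt_rpow_const _ _ (Or.inr (by linarith)))
        have h := this.tendsto
        simp only [Real.zero_rpow (show 1 - γ ≠ 0 by linarith), mul_zero] at h
        exact h.mono_left nhdsWithin_le_nhds
      refine tendsto_of_tendsto_of_tendsto_of_le_of_le' tendsto_const_nhds hl ?_ ?_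
      · filter_upwards [self_mem_nhdsWithin] with v hv
        have := (one_sub_bound hc hv.1 hv.2).1
        have := hv.1
        positivity
      · filter_upwards [self_mem_nhdsWithin] with v hv
        obtain ⟨b1, b2⟩ := one_sub_bound hc hv.1 hv.2
        rcases eq_or_lt_of_le hv.1 with rfl | h0
        · simp [Real.zero_rpow (show 1 - γ ≠ 0 by linarith)]
        · calc _ ≤ v ^ (-γ) * ((1 + c) * v) := by gcongr
            _ = _ := by rw [show 1 - γ = -γ + 1 by ring, Real.rpow_add h0, Real.rpow_one]; ring
    · apply ContinuousAt.continuousWithinAt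
      apply ContinuousAt.mul
      · exact Real.continuousAt_rpow_const _ _ (Or.inl h0.ne')
      · apply ContinuousAt.sub continuousAt_const
        apply ContinuousAt.rpow_const (by fun_prop)
        exact Or.inr hc.le
  · intro v hv
    have h1 := Real.hasDerivAt_rpow_const (x := v) (p := -γ) (Or.inl hv.1.ne')
    have h2 : HasDerivAt (fun v : ℝ => 1 - (1 - v) ^ c) (c * (1 - v) ^ (c - 1)) v := by
      have h3 : HasDerivAt (fun v : ℝ => 1 - v) (-1) v := by
        simpa using (hasDerivAt_id v).const_sub 1
      have := (h3.rpow_const (p := c) (Or.inl (by linarith [hv.2]))).const_sub 1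
      exact this.congr_deriv (by ring)
    refine (h1.mul h2).congr_deriv ?_
    rw [show 1 - γ - 1 = -γ by ring]; ring
  · rw [intervalIntegrable_iff_integrableOn_Ioo_of_le zero_le_one]
    exact (hI.const_mul _).add (hB.const_mul _)

lemma D_val {γ b : ℝ} (hγ : 0 < γ) (hγ1 : γ < 1) (hb : 0 < b + 1 - γ) :
    IntegrableOn (fun v : ℝ => v ^ (-γ - 1) * QQ b v) (Set.Ioi 0) ∧
    ∫ v in Set.Ioi (0:ℝ), v ^ (-γ - 1) * QQ b v =
      Real.Gamma (1 - γ) * Real.Gamma (b + 1) / (γ * Real.Gamma (b + 1 - γ)) := by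
  obtain ⟨hI, hv⟩ := D_one hγ hγ1 (show 0 < b + 1 by linarith)
  have hB := beta_int (α := 1 - γ) (β := b + 1) (by linarith) (by linarith)
  have hBv := beta_real (α := 1 - γ) (β := b + 1) (by linarith) (by linarith)
  have hu : Set.Ioi (0:ℝ) = Set.Ioo 0 1 ∪ Set.Ici 1 := (Set.Ioo_union_Ici_eq_Ioi zero_lt_one).symm
  have eqn : Set.EqOn (fun v : ℝ => v ^ (-γ - 1) * (1 - (1 - v) ^ (b+1)) - v ^ ((1 - γ) - 1) * (1 - v) ^ (b + 1 - 1))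
    (fun v : ℝ => v ^ (-γ - 1) * QQ b v) (Set.Ioo 0 1) := by
    intro v hv
    have h1 : 0 < 1 - v := by linarith [hv.2]
    simp only [QQ, hv.2, if_true]
    rw [show b + 1 - 1 = b by ring, Real.rpow_add h1, Real.rpow_one, show 1 - γ - 1 = (-γ - 1) + 1 by ring, Real.rpow_add hv.1, Real.rpow_one]
    ring
  have eqn2 : Set.EqOn (fun v : ℝ => v ^ (-γ - 1)) (fun v : ℝ => v ^ (-γ - 1) * QQ b v) (Set.Ici 1) := by
    intro v hv
    have : ¬ v < 1 := not_lt.2 hv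
    simp [QQ, this]
  have i1 := (hI.sub hB).congr_fun eqn measurableSet_Ioo
  have i2' : IntegrableOn (fun v : ℝ => v ^ (-γ - 1)) (Set.Ici 1) := by
    rw [integrableOn_Ici_iff_integrableOn_Ioi]
    exact integrableOn_Ioi_rpow_of_lt (by linarith) one_pos
  have i2 := i2'.congr_fun eqn2 measurableSet_Ici
  refine ⟨hu ▸ i1.union i2, ?_⟩
  have hd : Disjoint (Set.Ioo (0:ℝ) 1) (Set.Ici 1) := by
    rw [Set.disjoint_left]; intro x hx hx'
    exact absurd hx.2 (not_lt.2 hx')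
  rw [hu, setIntegral_union hd measurableSet_Ici i1 i2, ← setIntegral_congr_fun measurableSet_Ioo eqn,
    ← setIntegral_congr_fun measurableSet_Ici eqn2, integral_Ici_eq_integral_Ioi, integral_Ioi_rpow_of_lt (by linarith) one_pos,
    integral_sub hI hB]
  have hG : Real.Gamma (1 - γ + (b + 1)) = (b + 1 - γ) * Real.Gamma (b + 1 - γ) := by
    rw [← Real.Gamma_add_one hb.ne']; congr 1; ring
  rw [hG] at hBv
  rw [hBv] at hv ⊢
  have hG2 := Real.Gamma_pos_of_pos hb
  generalize (∫ v in Set.Ioo (0:ℝ) 1, v ^ (-γ - 1) * (1 - (1 - v) ^ (b+1))) = Y at *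
  simp
  have hY : Y = ((b + 1) * (Real.Gamma (1 - γ) * Real.Gamma (b + 1) / ((b + 1 - γ) * Real.Gamma (b + 1 - γ))) - 1) / γ := by
    rw [← hv]; field_simp
  rw [hY]
  field_simp
  ring

lemma rpow_taylor {m x : ℝ} (hm : 0 < m) (hx : |x| ≤ 1 / (2 * (1 + m))) :
    |(1 + x) ^ (-m) - 1 + m * x| ≤ 2 * m * (1 + m) * x ^ 2 := by
  have hm1 : 0 < 1 + m := by linarith
  have hx' : |x| * (2 * (1 + m)) ≤ 1 := by rwa [le_div_iff₀ (by positivity)] at hx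
  have hxa := abs_le.1 (show |x| ≤ 1/2 by nlinarith [abs_nonneg x])
  have h1x : 0 < 1 + x := by linarith
  have bern : ∀ y : ℝ, 0 < 1 + y → 1 - m * y ≤ (1 + y) ^ (-m) := by
    intro y hy
    rw [Real.rpow_def_of_pos hy]
    have h1 := Real.add_one_le_exp (Real.log (1 + y) * -m)
    have h2 := Real.log_le_sub_one_of_pos hy
    nlinarith
  have lo := bern x h1x
  have hi := bern (-x / (1 + x)) (by
    have : 1 + -x / (1 + x) = 1 / (1 + x) := by field_simp; ring
    rw [this]; positivity)
  have e1 : 1 + -x / (1 + x) = (1 + x)⁻¹ := by field_simp; ring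
  rw [e1, Real.inv_rpow h1x.le] at hi
  set T := (1 + x) ^ (-m) with hT
  have hTpos : 0 < T := by positivity
  have hy1 : -(1/2) ≤ (1 + m) * x := by
    have := neg_abs_le x
    nlinarith
  have hup : T * (1 + (1 + m) * x) ≤ 1 + x := by
    have h3 : 1 - m * (-x / (1+x)) = (1 + (1 + m) * x) / (1 + x) := by field_simp; ring
    rw [h3, div_le_iff₀ h1x] at hi
    have := mul_le_mul_of_nonneg_left hi hTpos.le
    rw [← mul_assoc, mul_inv_cancel₀ hTpos.ne', one_mul] at this
    exact this
  rw [abs_le]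
  constructor
  · have : 0 ≤ 2 * m * (1 + m) * x ^ 2 := by positivity
    linarith
  · set y := (1 + m) * x with hy
    have hpos : 0 < 1 + y := by linarith
    by_contra hcon
    push Not at hcon
    have h5 : (1 - m * x + 2 * m * (1 + m) * x ^ 2) * (1 + y) < T * (1 + y) := by
      apply mul_lt_mul_of_pos_right _ hpos
      linarith
    have h6 : (1 - m * x + 2 * m * (1 + m) * x ^ 2) * (1 + y) - (1 + x) = m * (1 + m) * x ^ 2 * (1 + 2 * y) := by
      rw [hy]; ring
    have h7 : 0 ≤ m * (1 + m) * x ^ 2 * (1 + 2 * y) := by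
      apply mul_nonneg (by positivity); linarith
    linarith

noncomputable def FF {n : ℕ} (e : EE n) (a : ℝ) (z : EE n) : ℝ :=
  (1 - ‖e + z‖ ^ (-a)) + (1 - ‖e - z‖ ^ (-a))

lemma FF_meas {n : ℕ} (e : EE n) (a : ℝ) : Measurable (FF e a) := by
  unfold FF; fun_prop

lemma FF_bound {n : ℕ} (e : EE n) (he : ‖e‖ = 1) {a : ℝ} (ha : 0 < a) :
    ∃ δ > 0, ∃ C, ∀ z, ‖z‖ < δ → |FF e a z| ≤ C * ‖z‖ ^ 2 := by
  set m := a / 2 with hm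
  have hm0 : 0 < m := by positivity
  set η := 1 / (2 * (1 + m)) with hη
  have hη0 : 0 < η := by positivity
  have hη1 : η ≤ 1 := by
    rw [hη, div_le_one (by positivity)]; linarith
  refine ⟨η / 3, by positivity, 2 * m + 2 * (2 * m * (1 + m) * 9), ?_⟩
  intro z hz
  have hz1 : ‖z‖ ≤ 1 := by linarith
  have hz0 := norm_nonneg z
  set q := inner ℝ e z with hq
  have hqb : |q| ≤ ‖z‖ := by
    have := abs_real_inner_le_norm e z
    rwa [he, one_mul] at this
  have hqb' := abs_le.1 hqb
  have n1 : ‖e + z‖ ^ (-a) = (1 + (2 * q + ‖z‖ ^ 2)) ^ (-m) := by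
    have : 1 + (2 * q + ‖z‖ ^ 2) = ‖e + z‖ ^ (2:ℝ) := by
      rw [Real.rpow_two, norm_add_sq_real, he]; ring
    rw [this, ← Real.rpow_mul (norm_nonneg _)]; congr 1; rw [hm]; ring
  have n2 : ‖e - z‖ ^ (-a) = (1 + (-2 * q + ‖z‖ ^ 2)) ^ (-m) := by
    have : 1 + (-2 * q + ‖z‖ ^ 2) = ‖e - z‖ ^ (2:ℝ) := by
      rw [Real.rpow_two, norm_sub_sq_real, he]; ring
    rw [this, ← Real.rpow_mul (norm_nonneg _)]; congr 1; rw [hm]; ring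
  have b1 : |2 * q + ‖z‖ ^ 2| ≤ 3 * ‖z‖ := by
    rw [abs_le]; constructor <;> nlinarith
  have b2 : |-2 * q + ‖z‖ ^ 2| ≤ 3 * ‖z‖ := by
    rw [abs_le]; constructor <;> nlinarith
  have t1 := rpow_taylor hm0 (x := 2 * q + ‖z‖ ^ 2) (b1.trans (by linarith))
  have t2 := rpow_taylor hm0 (x := -2 * q + ‖z‖ ^ 2) (b2.trans (by linarith))
  have s1 : (2 * q + ‖z‖ ^ 2) ^ 2 ≤ 9 * ‖z‖ ^ 2 := by
    have := sq_le_sq' (abs_le.1 b1).1 (abs_le.1 b1).2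
    linarith [this, mul_pow 3 ‖z‖ 2]
  have s2 : (-2 * q + ‖z‖ ^ 2) ^ 2 ≤ 9 * ‖z‖ ^ 2 := by
    have := sq_le_sq' (abs_le.1 b2).1 (abs_le.1 b2).2
    linarith [this, mul_pow 3 ‖z‖ 2]
  have hk : 0 ≤ 2 * m * (1 + m) := by positivity
  have u1 := mul_le_mul_of_nonneg_left s1 hk
  have u2 := mul_le_mul_of_nonneg_left s2 hk
  rw [FF, n1, n2]
  have t1' := abs_le.1 t1
  have t2' := abs_le.1 t2
  have hmz : 0 ≤ m * ‖z‖ ^ 2 := by positivity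
  rw [abs_le]
  constructor <;> nlinarith

lemma uu_sum {n : ℕ} (e : EE n) (p a : ℝ) (z : EE n) :
    (gk e p 0 (e + z) - gk e p a (e + z)) + (gk e p 0 (e - z) - gk e p a (e - z)) = ‖z‖ ^ (-p) * FF e a z := by
  simp only [gk, FF, neg_zero, Real.rpow_zero]
  rw [show e - (e + z) = -z by abel, show e - (e - z) = z by abel, norm_neg]
  ring

lemma DD_add {n : ℕ} (e z : EE n) (ε : ℝ) : e + z ∈ DD e ε ↔ ε < ‖z‖ := by
  show ε < ‖e + z - e‖ ↔ _
  rw [add_sub_cancel_left]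

lemma DD_sub {n : ℕ} (e z : EE n) (ε : ℝ) : e - z ∈ DD e ε ↔ ε < ‖z‖ := by
  show ε < ‖e - z - e‖ ↔ _
  rw [show e - z - e = -z by abel, norm_neg]

lemma trunc_eq {n : ℕ} (hn : 1 ≤ n) (e : EE n) (he : ‖e‖ = 1) {p a ε : ℝ} (hε : 0 < ε)
    (hp : n < p) (ha : 0 < a) (h2 : a < n) :
    Integrable ({z | ε < ‖z‖}.indicator fun z => ‖z‖ ^ (-p) * FF e a z) ∧
    2 * ∫ x in DD e ε, (gk e p 0 x - gk e p a x) =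
      ∫ z, {z | ε < ‖z‖}.indicator (fun z => ‖z‖ ^ (-p) * FF e a z) z := by
  have hn' : (1:ℝ) ≤ n := by exact_mod_cast hn
  have hI : Integrable ((DD e ε).indicator fun x => gk e p 0 x - gk e p a x) := by
    rw [integrable_indicator_iff (DD_meas e ε)]
    exact (gk_int hn e he hε (by linarith) (by linarith) (by linarith)).sub
      (gk_int hn e he hε (by linarith) (by linarith) (by linarith))
  have h1 := hI.comp_add_left e
  have h3 := hI.comp_sub_left e
  have hpt : ∀ z, {z | ε < ‖z‖}.indicator (fun z => ‖z‖ ^ (-p) * FF e a z) z =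
      (DD e ε).indicator (fun x => gk e p 0 x - gk e p a x) (e + z) + (DD e ε).indicator (fun x => gk e p 0 x - gk e p a x) (e - z) := by
    intro z
    by_cases hz : ε < ‖z‖
    · rw [Set.indicator_of_mem ((DD_add e z ε).2 hz), Set.indicator_of_mem ((DD_sub e z ε).2 hz), uu_sum, Set.indicator_of_mem (show z ∈ {z : EE n | ε < ‖z‖} from hz)]
    · rw [Set.indicator_of_notMem (mt (DD_add e z ε).1 hz), Set.indicator_of_notMem (mt (DD_sub e z ε).1 hz), Set.indicator_of_notMem (show z ∉ {z : EE n | ε < ‖z‖} from hz), add_zero]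
  constructor
  · exact (h1.add h3).congr (Eventually.of_forall fun z => (hpt z).symm)
  · simp_rw [hpt]
    rw [integral_add h1 h3, integral_add_left_eq_self (fun x => (DD e ε).indicator (fun x => gk e p 0 x - gk e p a x) x) e,
      integral_sub_left_eq_self (fun x => (DD e ε).indicator (fun x => gk e p 0 x - gk e p a x) x), integral_indicator (DD_meas e ε)]
    ring

lemma FF_int {n : ℕ} (hn : 1 ≤ n) (e : EE n) (he : ‖e‖ = 1) {p a : ℝ}
    (hp : n < p) (hp2 : p < n + 2) (ha : 0 < a) (h2 : a < n) :
    Integrable (fun z => ‖z‖ ^ (-p) * FF e a z) := by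
  obtain ⟨δ, hδ, C, hC⟩ := FF_bound e he ha
  have hm : Measurable (fun z => ‖z‖ ^ (-p) * FF e a z) := by
    have := FF_meas e a
    fun_prop
  have h1 : IntegrableOn (fun z => ‖z‖ ^ (-p) * FF e a z) (Metric.ball 0 δ) := by
    refine integrableOn_ball_of_norm_le_rpow (C := C) (α := p - 2) (by simpa using hn) (by rw [dim_EE]; linarith) ?_ hm.aestronglyMeasurable
    refine (ae_restrict_iff' Metric.isOpen_ball.measurableSet).2 (Eventually.of_forall fun z hz => ?_)
    have hz : ‖z‖ < δ := by simpa using hz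
    by_cases hz0 : z = 0
    · simp [hz0, Real.zero_rpow (show -p ≠ 0 by
        have : (0:ℝ) ≤ n := by positivity
        linarith)]
      have hb : ∀ t, 0 ≤ t → t < δ → 0 ≤ C * t ^ 2 := by
        intro t ht ht'
        have : ‖t • e‖ = t := by rw [norm_smul, he, Real.norm_of_nonneg ht, mul_one]
        have h := hC (t • e) (by rw [this]; exact ht')
        rw [this] at h
        exact (abs_nonneg _).trans h
      have := hb (δ/2) (by linarith) (by linarith)
      have hC0 : 0 ≤ C := by
        by_contra hneg
        push Not at hneg
        have : C * (δ/2)^2 < 0 := mul_neg_of_neg_of_pos hneg (by positivity)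
        linarith
      positivity
    · have h0 : 0 < ‖z‖ := norm_pos_iff.2 hz0
      rw [norm_mul, Real.norm_of_nonneg (by positivity), Real.norm_eq_abs]
      calc _ ≤ ‖z‖ ^ (-p) * (C * ‖z‖ ^ 2) := by gcongr; exact hC z hz
        _ = _ := by
          rw [show -(p - 2) = -p + 2 by ring, Real.rpow_add h0, Real.rpow_two]; ring
  have h3 := (trunc_eq hn e he (show 0 < δ/2 by linarith) hp ha h2).1
  rw [integrable_indicator_iff (by apply measurableSet_lt <;> fun_prop)] at h3
  rw [← integrableOn_univ]
  refine (h1.union h3).mono_set fun z _ => ?_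
  by_cases h : ‖z‖ < δ
  · left; simpa using h
  · right; show δ/2 < ‖z‖; linarith

lemma limk_eq {n : ℕ} (hn : 1 ≤ n) (e : EE n) (he : ‖e‖ = 1) {p a k : ℝ}
    (hp : n < p) (hp2 : p < n + 2) (ha : 0 < a) (h2 : a < n)
    (hk : Tendsto (fun ε => ∫ x in DD e ε, (gk e p 0 x - gk e p a x)) (𝓝[>] 0) (𝓝 k)) :
    2 * k = ∫ z, ‖z‖ ^ (-p) * FF e a z := by
  have hI := FF_int hn e he hp hp2 ha h2
  have h1 : Tendsto (fun ε : ℝ => ∫ z, {z | ε < ‖z‖}.indicator (fun z => ‖z‖ ^ (-p) * FF e a z) z) (𝓝[>] 0)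
      (𝓝 (∫ z, ‖z‖ ^ (-p) * FF e a z)) := by
    refine tendsto_integral_filter_of_dominated_convergence _ ?_ ?_ hI.norm ?_
    · refine Eventually.of_forall fun ε => ?_
      exact hI.aestronglyMeasurable.indicator (by apply measurableSet_lt <;> fun_prop)
    · exact Eventually.of_forall fun ε => Eventually.of_forall fun z => norm_indicator_le_norm_self _ _
    · have hz : ∀ᵐ x : EE n, x ≠ 0 := by
        have : Nontrivial (EE n) := by
          apply Module.nontrivial_of_finrank_pos (R := ℝ)
          simp; omega
        simp [ae_iff]
      filter_upwards [hz] with z hz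
      apply tendsto_const_nhds.congr'
      have : ∀ᶠ ε : ℝ in 𝓝[>] 0, ε < ‖z‖ := nhdsWithin_le_nhds (Iio_mem_nhds (norm_pos_iff.2 hz))
      filter_upwards [this] with ε hε
      rw [Set.indicator_of_mem (show z ∈ {z : EE n | ε < ‖z‖} from hε)]
  refine tendsto_nhds_unique (hk.const_mul 2) (h1.congr' ?_)
  filter_upwards [self_mem_nhdsWithin] with ε hε
  exact (trunc_eq hn e he hε hp ha h2).2.symm

lemma ae_ne_zero {n : ℕ} (hn : 1 ≤ n) : ∀ᵐ x : EE n, x ≠ 0 := by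
  have : Nontrivial (EE n) := by
    apply Module.nontrivial_of_finrank_pos (R := ℝ)
    simp; omega
  simp [ae_iff]

lemma gauss_eq {n : ℕ} {r : ℝ} (hr : 0 < r) :
    ∫ z : EE n, Real.exp (-r * ‖z‖ ^ 2) = (Real.pi / r) ^ ((n:ℝ) / 2) := by
  have := GaussianFourier.integral_rexp_neg_mul_sq_norm (V := EE n) hr
  rwa [dim_EE] at this

lemma gauss_int {n : ℕ} {r : ℝ} (hr : 0 < r) :
    Integrable fun z : EE n => Real.exp (-r * ‖z‖ ^ 2) := by
  apply Integrable.of_integral_ne_zero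
  rw [gauss_eq hr]; positivity

lemma gauss_two {n : ℕ} (e : EE n) (he : ‖e‖ = 1) {s t : ℝ} (hs : 0 < s) (ht : 0 < t) :
    ∫ x : EE n, Real.exp (-(‖x‖ ^ 2 * t)) * Real.exp (-s * ‖x - e‖ ^ 2) =
      (Real.pi / (s + t)) ^ ((n:ℝ) / 2) * Real.exp (-(s * t / (s + t))) := by
  have hst : 0 < s + t := by positivity
  have h : ∀ x : EE n, Real.exp (-(‖x‖ ^ 2 * t)) * Real.exp (-s * ‖x - e‖ ^ 2) =
      Real.exp (-(s + t) * ‖x - (s / (s + t)) • e‖ ^ 2) * Real.exp (-(s * t / (s + t))) := by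
    intro x
    rw [← Real.exp_add, ← Real.exp_add]
    congr 1
    rw [norm_sub_sq_real, norm_sub_sq_real, inner_smul_right, norm_smul, he, mul_one, Real.norm_eq_abs, sq_abs]
    field_simp
    ring
  simp_rw [h]
  rw [integral_mul_const, integral_sub_right_eq_self (fun x : EE n => Real.exp (-(s + t) * ‖x‖ ^ 2)), gauss_eq hst]

lemma rg_int {n : ℕ} (hn : 1 ≤ n) (e : EE n) {a s : ℝ} (ha : 0 < a) (h2 : a < n) (hs : 0 < s) :
    Integrable fun x : EE n => ‖x‖ ^ (-a) * Real.exp (-s * ‖x - e‖ ^ 2) := by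
  have hm : Measurable fun x : EE n => ‖x‖ ^ (-a) * Real.exp (-s * ‖x - e‖ ^ 2) := by fun_prop
  have hg : Integrable fun x : EE n => Real.exp (-s * ‖x - e‖ ^ 2) := (gauss_int hs).comp_sub_right e
  rw [← integrableOn_univ, ← Set.union_compl_self (Metric.ball (0 : EE n) 1)]
  refine IntegrableOn.union ?_ ?_
  · refine Integrable.mono' (rpow_int_ball hn h2) hm.aestronglyMeasurable (Eventually.of_forall fun x => ?_)
    rw [Real.norm_of_nonneg (by positivity)]
    apply mul_le_of_le_one_right (by positivity)
    rw [Real.exp_le_one_iff]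
    nlinarith [sq_nonneg ‖x - e‖]
  · refine Integrable.mono' hg.integrableOn hm.aestronglyMeasurable ?_
    refine (ae_restrict_iff' Metric.isOpen_ball.measurableSet.compl).2 (Eventually.of_forall fun x hx => ?_)
    have hx : 1 ≤ ‖x‖ := by simpa using hx
    rw [Real.norm_of_nonneg (by positivity)]
    apply mul_le_of_le_one_left (by positivity)
    exact Real.rpow_le_one_of_one_le_of_nonpos hx (by linarith)

lemma sq_rpow {n : ℕ} (x : EE n) (a : ℝ) : (‖x‖ ^ 2) ^ (-(a / 2)) = ‖x‖ ^ (-a) := by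
  rw [← Real.rpow_two, ← Real.rpow_mul (norm_nonneg _)]; congr 1; ring

lemma cov {n : ℝ} {a s : ℝ} (hs : 0 < s) :
    ∫ t in Set.Ioi (0:ℝ), t ^ (a / 2 - 1) * ((Real.pi / (s + t)) ^ (n / 2) * Real.exp (-(s * t / (s + t)))) =
    (Real.pi / s) ^ (n / 2) * s ^ (a / 2) *
      ∫ v in Set.Ioo (0:ℝ) 1, v ^ (a / 2 - 1) * (1 - v) ^ (n / 2 - a / 2 - 1) * Real.exp (-(s * v)) := by
  have himg : (fun v : ℝ => s * (v / (1 - v))) '' Set.Ioo 0 1 = Set.Ioi 0 := by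
    ext t
    constructor
    · rintro ⟨v, hv, rfl⟩
      have h1 : 0 < 1 - v := by linarith [hv.2]
      have h0 := hv.1
      show 0 < s * (v / (1 - v))
      positivity
    · intro ht
      have ht : 0 < t := ht
      refine ⟨t / (s + t), ⟨by positivity, by rw [div_lt_one (by positivity)]; linarith⟩, ?_⟩
      have : 1 - t / (s + t) = s / (s + t) := by field_simp; ring
      simp only [this]
      field_simp
  rw [← himg, integral_image_eq_integral_abs_deriv_smul measurableSet_Ioo (f' := fun v => s / (1 - v) ^ 2), ← integral_const_mul]
  · refine setIntegral_congr_fun measurableSet_Ioo fun v hv => ?_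
    have h1 : 0 < 1 - v := by linarith [hv.2]
    have h0 := hv.1
    have e1 : s + s * (v / (1 - v)) = s / (1 - v) := by field_simp; ring
    simp only [e1]
    have e2 : s * (s * (v / (1 - v))) / (s / (1 - v)) = s * v := by field_simp
    have e3 : Real.pi / (s / (1 - v)) = Real.pi / s * (1 - v) := by field_simp
    rw [e2, e3, abs_of_pos (by positivity), Real.mul_rpow (by positivity) h1.le, Real.mul_rpow hs.le (by positivity), Real.div_rpow h0.le h1.le, smul_eq_mul]
    rw [show n / 2 - a / 2 - 1 = n / 2 - (a / 2 - 1) - (2:ℕ) by push_cast; ring, Real.rpow_sub h1, Real.rpow_sub h1, Real.rpow_natCast]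
    rw [show s ^ (a / 2) = s ^ (a/2 - 1) * s by rw [Real.rpow_sub hs, Real.rpow_one]; field_simp]
    field_simp
    rw [← Real.rpow_add h1, ← Real.rpow_add h1]
    congr 1; ring
  · intro v hv
    have h1 : 1 - v ≠ 0 := by linarith [hv.2]
    have h3 : HasDerivAt (fun v : ℝ => 1 - v) (-1) v := by
      simpa using (hasDerivAt_id v).const_sub 1
    have := (((hasDerivAt_id v).div h3 h1).const_mul s).congr_deriv (g' := s / (1 - v) ^ 2) (by
      simp only [id]; field_simp; ring)
    exact this.hasDerivWithinAt
  · intro v hv w hw h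
    have h1 : 0 < 1 - v := by linarith [hv.2]
    have h2 : 0 < 1 - w := by linarith [hw.2]
    simp only at h
    have h := mul_left_cancel₀ hs.ne' h
    rw [div_eq_div_iff h1.ne' h2.ne'] at h
    linarith

lemma FFgauss {n : ℕ} (hn : 1 ≤ n) (e : EE n) (he : ‖e‖ = 1) {a s : ℝ} (ha : 0 < a) (h2 : a < n) (hs : 0 < s) :
    ∫ z, Real.exp (-(‖z‖ ^ 2 * s)) * FF e a z =
      2 * ((Real.pi / s) ^ ((n:ℝ) / 2) * s ^ (a / 2) / Real.Gamma (a / 2)) *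
        ∫ v in Set.Ioi (0:ℝ), Real.exp (-(v * s)) * (v ^ (a / 2 - 1) * QQ ((n:ℝ) / 2 - a / 2 - 1) v) := by
  have ha2 : 0 < a / 2 := by positivity
  have hG := Real.Gamma_pos_of_pos ha2
  set b : ℝ := (n:ℝ) / 2 - a / 2 - 1 with hb
  have hrg := rg_int hn e ha h2 hs
  have hg : Integrable fun x : EE n => Real.exp (-s * ‖x - e‖ ^ 2) := (gauss_int hs).comp_sub_right e
  -- the Riesz-Gauss integral
  have L := laplace_fubini (volume : Measure (EE n)) (φ := fun x => ‖x‖ ^ 2) (h := fun x => Real.exp (-s * ‖x - e‖ ^ 2))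
    (by fun_prop) (by fun_prop) (by
      filter_upwards [ae_ne_zero hn] with x hx
      have := norm_pos_iff.2 hx
      positivity) ha2 (by simpa only [sq_rpow] using hrg)
  simp only [sq_rpow] at L
  rw [setIntegral_congr_fun measurableSet_Ioi (g := fun t : ℝ => t ^ (a / 2 - 1) * ((Real.pi / (s + t)) ^ ((n:ℝ) / 2) * Real.exp (-(s * t / (s + t)))))
    (fun t ht => by simp only [gauss_two e he hs ht]), cov hs] at L
  -- symmetrization
  let u : EE n → ℝ := fun x => Real.exp (-s * ‖x - e‖ ^ 2) - ‖x‖ ^ (-a) * Real.exp (-s * ‖x - e‖ ^ 2)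
  have hu : Integrable u := hg.sub hrg
  have e1 : ∀ z, Real.exp (-(‖z‖ ^ 2 * s)) * FF e a z = u (e + z) + u (e - z) := by
    intro z
    simp only [u, FF]
    rw [show e + z - e = z by abel, show e - z - e = -z by abel, norm_neg, show -s * ‖z‖^2 = -(‖z‖^2*s) by ring]
    ring
  simp_rw [e1]
  rw [integral_add (hu.comp_add_left e) (hu.comp_sub_left e), integral_add_left_eq_self u e, integral_sub_left_eq_self u, integral_sub hg hrg,
    integral_sub_right_eq_self (fun x : EE n => Real.exp (-s * ‖x‖ ^ 2)), gauss_eq hs]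
  have Rv : ∫ x : EE n, ‖x‖ ^ (-a) * Real.exp (-s * ‖x - e‖ ^ 2) = (Real.pi / s) ^ ((n:ℝ) / 2) * s ^ (a / 2) / Real.Gamma (a/2) *
      ∫ v in Set.Ioo (0:ℝ) 1, v ^ (a / 2 - 1) * (1 - v) ^ b * Real.exp (-(s * v)) := by
    rw [eq_comm, div_mul_eq_mul_div, div_eq_iff hG.ne', L]; ring
  rw [Rv]
  -- the Gamma part
  have gi := gam_int ha2 hs
  have gv := Real.integral_rpow_mul_exp_neg_mul_Ioi ha2 hs
  have bi : IntegrableOn (fun v : ℝ => v ^ (a / 2 - 1) * (1 - v) ^ b * Real.exp (-(s * v))) (Set.Ioo 0 1) := by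
    have hbi := beta_int (α := a / 2) (β := b + 1) ha2 (by rw [hb]; linarith)
    rw [show b + 1 - 1 = b by ring] at hbi
    refine Integrable.mono' hbi (by apply Measurable.aestronglyMeasurable; fun_prop) ?_
    refine (ae_restrict_iff' measurableSet_Ioo).2 (Eventually.of_forall fun v hv => ?_)
    have h1 : 0 < 1 - v := by linarith [hv.2]
    have h0 := hv.1
    rw [Real.norm_of_nonneg (by positivity)]
    apply mul_le_of_le_one_right (by positivity)
    rw [Real.exp_le_one_iff]
    nlinarith
  have bi' := (integrable_indicator_iff measurableSet_Ioo).2 bi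
  have Qv : ∫ v in Set.Ioi (0:ℝ), Real.exp (-(v * s)) * (v ^ (a / 2 - 1) * QQ b v) =
      (1 / s) ^ (a / 2) * Real.Gamma (a / 2) - ∫ v in Set.Ioo (0:ℝ) 1, v ^ (a / 2 - 1) * (1 - v) ^ b * Real.exp (-(s * v)) := by
    have h5 : ∫ v in Set.Ioo (0:ℝ) 1, v ^ (a / 2 - 1) * (1 - v) ^ b * Real.exp (-(s * v)) =
        ∫ v in Set.Ioi (0:ℝ), (Set.Ioo (0:ℝ) 1).indicator (fun v => v ^ (a / 2 - 1) * (1 - v) ^ b * Real.exp (-(s * v))) v := by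
      rw [setIntegral_indicator measurableSet_Ioo]
      congr 2
      ext x; constructor
      · intro hx; exact ⟨hx.1, hx⟩
      · intro hx; exact hx.2
    rw [h5, ← gv, ← integral_sub gi bi'.integrableOn]
    refine setIntegral_congr_fun measurableSet_Ioi fun v hv => ?_
    have hv : 0 < v := hv
    by_cases h1 : v < 1
    · rw [Set.indicator_of_mem (show v ∈ Set.Ioo (0:ℝ) 1 from ⟨hv, h1⟩)]
      simp only [QQ, h1, if_true]
      rw [mul_comm v s]
      ring
    · rw [Set.indicator_of_notMem (show v ∉ Set.Ioo (0:ℝ) 1 from fun h => h1 h.2)]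
      simp only [QQ, h1, if_false]
      rw [mul_comm v s]
      ring
  rw [Qv, one_div, Real.inv_rpow hs.le]
  have hsp : 0 < s ^ (a/2) := by positivity
  field_simp
  ring

lemma FF_value {n : ℕ} (hn : 1 ≤ n) (e : EE n) (he : ‖e‖ = 1) {γ a : ℝ} (hγ : 0 < γ) (hγ1 : γ < 1)
    (ha : 0 < a) (h2 : a < n - 2 * γ) :
    Real.Gamma ((n:ℝ)/2 + γ) * ∫ z, ‖z‖ ^ (-((n:ℝ) + 2 * γ)) * FF e a z =
      2 * Real.pi ^ ((n:ℝ)/2) * (Real.Gamma (γ + a/2) / Real.Gamma (a/2)) *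
        (Real.Gamma (1 - γ) * Real.Gamma (((n:ℝ) - a)/2) / (γ * Real.Gamma (((n:ℝ) - a)/2 - γ))) := by
  set p : ℝ := (n:ℝ) + 2 * γ with hp
  set b : ℝ := (n:ℝ) / 2 - a / 2 - 1 with hb
  have hFi := FF_int hn e he (p := p) (a := a) (by linarith) (by linarith) ha (by linarith)
  have L := laplace_fubini (volume : Measure (EE n)) (φ := fun x => ‖x‖ ^ 2) (h := FF e a) (m := p / 2)
    (by fun_prop) (FF_meas e a) (by
      filter_upwards [ae_ne_zero hn] with x hx
      have := norm_pos_iff.2 hx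
      positivity) (by positivity) (by simpa only [sq_rpow] using hFi)
  simp only [sq_rpow] at L
  rw [show (n:ℝ)/2 + γ = p / 2 by rw [hp]; ring, ← L]
  obtain ⟨Di, Dv⟩ := D_val hγ hγ1 (b := b) (by rw [hb]; linarith)
  have hre : Set.EqOn (fun v : ℝ => v ^ (-γ - 1) * QQ b v) (fun v : ℝ => v ^ (-(γ + a/2)) * (v ^ (a/2 - 1) * QQ b v)) (Set.Ioi 0) := by
    intro v hv
    simp only
    rw [← mul_assoc, ← Real.rpow_add hv]; congr 2; ring
  have L2 := laplace_fubini (volume.restrict (Set.Ioi (0:ℝ))) (φ := fun v => v) (h := fun v => v ^ (a/2 - 1) * QQ b v) (m := γ + a/2)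
    (by fun_prop) (by have := QQ_meas b; fun_prop) (ae_restrict_mem measurableSet_Ioi) (by positivity)
    (Di.congr_fun hre measurableSet_Ioi)
  rw [← setIntegral_congr_fun measurableSet_Ioi hre, Dv] at L2
  have hfin : ∫ s in Set.Ioi (0:ℝ), s ^ (p/2 - 1) * ∫ x, Real.exp (-(‖x‖ ^ 2 * s)) * FF e a x =
      ∫ s in Set.Ioi (0:ℝ), (2 * Real.pi ^ ((n:ℝ)/2) / Real.Gamma (a/2)) * (s ^ (γ + a/2 - 1) *
        ∫ v in Set.Ioi (0:ℝ), Real.exp (-(v * s)) * (v ^ (a / 2 - 1) * QQ b v)) := by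
    refine setIntegral_congr_fun measurableSet_Ioi fun s hs => ?_
    have hs : 0 < s := hs
    rw [FFgauss hn e he ha (by linarith) hs, Real.div_rpow Real.pi_pos.le hs.le,
      show γ + a/2 - 1 = (p/2 - 1) - (n:ℝ)/2 + a/2 by rw [hp]; ring, Real.rpow_add hs, Real.rpow_sub hs (p/2 - 1), ← hb]
    generalize (∫ v in Set.Ioi (0:ℝ), Real.exp (-(v * s)) * (v ^ (a / 2 - 1) * QQ b v)) = I
    generalize s ^ (p/2 - 1) = J
    ring
  rw [hfin, integral_const_mul, L2]
  rw [show b + 1 = ((n:ℝ) - a)/2 by rw [hb]; ring]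
  ring

theorem stmt16 (n : ℕ) (γ : ℝ) (hn : 2 ≤ n) (hγ : γ ∈ Set.Ioo (0:ℝ) 1)
    (κ : ℝ → ℝ)
    (hκ : ∀ α ∈ Set.Ioo (-(2*γ)) (((n:ℝ) - 2*γ)/2),
      Tendsto (fun ε : ℝ =>
          ∫ ζ in {ζ : EuclideanSpace ℝ (Fin n) |
              ε < ‖ζ - EuclideanSpace.single (⟨0, by omega⟩ : Fin n) (1:ℝ)‖},
            (1 - ‖ζ‖ ^ (-(((n:ℝ) - 2*γ)/2 - α))) /
              (‖EuclideanSpace.single (⟨0, by omega⟩ : Fin n) (1:ℝ) - ζ‖ ^ ((n:ℝ) + 2*γ)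
                * ‖ζ‖ ^ α))
        (𝓝[>] 0) (𝓝 (κ α))) :
    let ς : ℝ := Real.pi ^ (-(n:ℝ)/2) * 2 ^ (2*γ) *
      (Real.Gamma ((n:ℝ)/2 + γ) / Real.Gamma (1 - γ)) * γ
    let c : ℝ := 2 ^ (2*γ) *
      (Real.Gamma ((1/2) * ((n:ℝ)/2 + γ)) / Real.Gamma ((1/2) * ((n:ℝ)/2 - γ)))^2
    StrictAntiOn (fun α => ς * κ α - c) (Set.Ioo (-(2*γ)) (((n:ℝ) - 2*γ)/2)) ∧
    ς * κ 0 - c = 0 ∧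
    ∀ α ∈ Set.Ioo (-(2*γ)) (((n:ℝ) - 2*γ)/2), 0 < (ς * κ α - c) + c := by
  intro ς c
  obtain ⟨hγ0, hγ1⟩ := hγ
  have hn1 : 1 ≤ n := by omega
  have hnr : (2:ℝ) ≤ n := by exact_mod_cast hn
  generalize hedef : (EuclideanSpace.single (⟨0, by omega⟩ : Fin n) (1:ℝ) : EE n) = e at hκ
  have he : ‖e‖ = 1 := by rw [← hedef]; simp
  set p : ℝ := (n:ℝ) + 2*γ with hp
  set a : ℝ := ((n:ℝ) - 2*γ)/2 with ha
  have ha0 : 0 < a := by rw [ha]; linarith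
  have hlim : ∀ α ∈ Set.Ioo (-(2*γ)) a,
      Tendsto (fun ε : ℝ => ∫ x in DD e ε, (gk e p α x - gk e p a x)) (𝓝[>] 0) (𝓝 (κ α)) := by
    intro α hα
    refine (hκ α hα).congr fun ε => ?_
    refine setIntegral_congr_ae (DD_meas e ε) ?_
    filter_upwards [ae_ne_zero hn1] with x hx _
    have h0 : 0 < ‖x‖ := norm_pos_iff.2 hx
    rw [gk, gk, Real.rpow_neg (norm_nonneg (e - x)), show -a = -(a - α) + -α by ring, Real.rpow_add h0, Real.rpow_neg h0.le α, div_eq_mul_inv, mul_inv]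
    ring
  have hς : 0 < ς := by
    have := Real.Gamma_pos_of_pos (show 0 < (n:ℝ)/2 + γ by positivity)
    have := Real.Gamma_pos_of_pos (show 0 < 1 - γ by linarith)
    simp only [ς]
    positivity
  have hev : ∀ᶠ ε : ℝ in 𝓝[>] 0, 0 < ε ∧ ε < 1/2 := by
    filter_upwards [self_mem_nhdsWithin, nhdsWithin_le_nhds (Iio_mem_nhds (show (0:ℝ) < 1/2 by norm_num))] with ε h1 h2
    exact ⟨h1, h2⟩
  have hpos : ∀ α ∈ Set.Ioo (-(2*γ)) a, 0 < κ α := by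
    intro α hα
    obtain ⟨δ, hδ, h⟩ := mono_main hn1 e he hγ0 hα.1 hα.2 le_rfl
    refine hδ.trans_le (ge_of_tendsto (hlim α hα) ?_)
    filter_upwards [hev] with ε hε using h ε hε.1 hε.2
  have hanti : ∀ α ∈ Set.Ioo (-(2*γ)) a, ∀ β ∈ Set.Ioo (-(2*γ)) a, α < β → κ β < κ α := by
    intro α hα β hβ hαβ
    obtain ⟨δ, hδ, h⟩ := mono_main hn1 e he hγ0 hα.1 hαβ hβ.2.le
    have := ge_of_tendsto (b := δ) ((hlim α hα).sub (hlim β hβ)) (by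
      filter_upwards [hev] with ε hε
      have h1 := h ε hε.1 hε.2
      have hi : ∀ q, -(2*γ) < q → q < n → IntegrableOn (gk e p q) (DD e ε) := by
        intro q hq hq'
        exact gk_int hn1 e he hε.1 (by positivity) (by linarith) hq'
      have i1 := hi α hα.1 (by linarith [hα.2])
      have i2 := hi β hβ.1 (by linarith [hβ.2])
      have i3 := hi a (by linarith) (by linarith)
      rw [integral_sub i1 i2] at h1
      rw [integral_sub i1 i3, integral_sub i2 i3]
      linarith)
    linarith
  refine ⟨?_, ?_, ?_⟩
  · intro α hα β hβ hαβ
    have := mul_lt_mul_of_pos_left (hanti α hα β hβ hαβ) hς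
    simp only
    linarith
  · have h0 := hlim 0 ⟨by linarith, ha0⟩
    have h1 := limk_eq hn1 e he (by linarith) (by linarith) ha0 (by linarith) h0
    have h2 := FF_value hn1 e he hγ0 hγ1 ha0 (by linarith)
    rw [← h1] at h2
    have g1 := Real.Gamma_pos_of_pos (show 0 < (n:ℝ)/2 + γ by positivity)
    have g2 := Real.Gamma_pos_of_pos (show 0 < 1 - γ by linarith)
    have e1 : γ + a/2 = (1/2) * ((n:ℝ)/2 + γ) := by rw [ha]; ring
    have e2 : a/2 = (1/2) * ((n:ℝ)/2 - γ) := by rw [ha]; ring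
    have e3 : ((n:ℝ) - a)/2 = (1/2) * ((n:ℝ)/2 + γ) := by rw [ha]; ring
    have e4 : ((n:ℝ) - a)/2 - γ = (1/2) * ((n:ℝ)/2 - γ) := by rw [ha]; ring
    have g3 := Real.Gamma_pos_of_pos (show 0 < (1/2) * ((n:ℝ)/2 - γ) by rw [← e2]; positivity)
    rw [e4, e1, e2, e3] at h2
    simp only [ς, c]
    generalize Real.Gamma ((1/2) * ((n:ℝ)/2 + γ)) = X at *
    generalize Real.Gamma ((1/2) * ((n:ℝ)/2 - γ)) = Y at *
    generalize Real.Gamma ((n:ℝ)/2 + γ) = Z at *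
    generalize Real.Gamma (1 - γ) = G at *
    have hk : κ 0 = Real.pi ^ ((n:ℝ)/2) * (X / Y) * (G * X / (γ * Y)) / Z := by
      rw [eq_div_iff g1.ne']; linarith
    rw [hk, neg_div, Real.rpow_neg Real.pi_pos.le]
    have : 0 < Real.pi ^ ((n:ℝ)/2) := by positivity
    field_simp
    ring
  · intro α hα
    have := mul_pos hς (hpos α hα)
    linarith
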